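/- Let a : [-1,1] × [0,∞) → [0,∞) be continuous and F ∈ 𝔉. If the inequality I(a,u*) ≤ I(a,u) holds for every nonnegative piecewise linear function u on [-1,1], then it holds for every nonnegative Lipschitz function u on [-1,1]. -/

import Mathlib

open MeasureTheory Set Filter
open scoped ENNReal BigOperators NNReal

noncomputable section

/-- `u ∈ W¹₁(-1,1)`: `u` is absolutely continuous on `[-1,1]` with (a.e.) derivative in `L¹`,
encoded via the fundamental theorem of calculus with the pointwise derivative `deriv u`. -/
def MemW11 (u : ℝ → ℝ) : Prop :=
  IntegrableOn (deriv u) (Icc (-1 : ℝ) 1) volume ∧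
  ∀ x ∈ Icc (-1 : ℝ) 1, u x = u (-1) + ∫ t in (-1 : ℝ)..x, deriv u t

/-- Convergence `u_k → u` in `W¹₁(-1,1)`. -/
def W11Tendsto (uk : ℕ → ℝ → ℝ) (u : ℝ → ℝ) : Prop :=
  Tendsto (fun k => ∫ x in Icc (-1 : ℝ) 1, (|uk k x - u x| + |deriv (uk k) x - deriv u x|))
    atTop (nhds 0)

/-- `F ∈ 𝔉`: continuous, nonnegative, convex and nondecreasing in the second argument. -/
def MemFrakF (F : ℝ → ℝ → ℝ) : Prop :=
  ContinuousOn (fun p : ℝ × ℝ => F p.1 p.2) (Ici (0 : ℝ) ×ˢ Ici (0 : ℝ)) ∧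
  (∀ v p : ℝ, 0 ≤ v → 0 ≤ p → 0 ≤ F v p) ∧
  (∀ v : ℝ, 0 ≤ v → ConvexOn ℝ (Ici (0 : ℝ)) (F v)) ∧
  (∀ v : ℝ, 0 ≤ v → MonotoneOn (F v) (Ici (0 : ℝ)))

/-- A continuous nonnegative weight on `[-1,1] × [0,∞)`. -/
def Weight (a : ℝ → ℝ → ℝ) : Prop :=
  ContinuousOn (fun p : ℝ × ℝ => a p.1 p.2) (Icc (-1 : ℝ) 1 ×ˢ Ici (0 : ℝ)) ∧
  ∀ x v : ℝ, x ∈ Icc (-1 : ℝ) 1 → 0 ≤ v → 0 ≤ a x v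

/-- Condition (C): `a(s,v) + a(t,v) ≥ a(1 - t + s, v)` for `-1 ≤ s ≤ t ≤ 1`, `v ≥ 0`. -/
def CondC (a : ℝ → ℝ → ℝ) : Prop :=
  ∀ s t v : ℝ, -1 ≤ s → s ≤ t → t ≤ 1 → 0 ≤ v → a (1 - t + s) v ≤ a s v + a t v

/-- Condition (C) for a one-variable weight. -/
def CondC1 (a : ℝ → ℝ) : Prop :=
  ∀ s t : ℝ, -1 ≤ s → s ≤ t → t ≤ 1 → a (1 - t + s) ≤ a s + a t

/-- Condition (C'): `a(s,v) + a(t,v) ≥ a((s-t)/2, v) + a((t-s)/2, v)`. -/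
def CondC' (a : ℝ → ℝ → ℝ) : Prop :=
  ∀ s t v : ℝ, s ∈ Icc (-1 : ℝ) 1 → t ∈ Icc (-1 : ℝ) 1 → 0 ≤ v →
    a ((s - t) / 2) v + a ((t - s) / 2) v ≤ a s v + a t v

/-- The functional `I(a,u) = ∫_{-1}^1 F(u(x), a(x,u(x))·|u'(x)|) dx ∈ [0,∞]`. -/
def Ifun (F a : ℝ → ℝ → ℝ) (u : ℝ → ℝ) : ℝ≥0∞ :=
  ∫⁻ x in Icc (-1 : ℝ) 1, ENNReal.ofReal (F (u x) (a x (u x) * |deriv u x|))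

/-- The monotone rearrangement `u*(x) = ∫₀^∞ χ_{[1-|A_t|,1]}(x) dt`,
where `A_t = {y ∈ [-1,1] : u(y) > t}`. -/
def mrear (u : ℝ → ℝ) (x : ℝ) : ℝ :=
  ∫ t in Ioi (0 : ℝ),
    (Icc (1 - (volume {y ∈ Icc (-1 : ℝ) 1 | u y > t}).toReal) 1).indicator
      (fun _ => (1 : ℝ)) x

/-- The symmetric rearrangement `ū(x) = ∫₀^∞ χ_{[-|A_t|/2, |A_t|/2]}(x) dt`. -/
def srear (u : ℝ → ℝ) (x : ℝ) : ℝ :=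
  ∫ t in Ioi (0 : ℝ),
    (Icc (-((volume {y ∈ Icc (-1 : ℝ) 1 | u y > t}).toReal / 2))
        ((volume {y ∈ Icc (-1 : ℝ) 1 | u y > t}).toReal / 2)).indicator
      (fun _ => (1 : ℝ)) x

/-- `u` is piecewise linear on `[-1,1]`: there is a partition `-1 = x₀ < ⋯ < x_n = 1`
such that `u` is affine on each `[x_i, x_{i+1}]`. -/
def PiecewiseLinear (u : ℝ → ℝ) : Prop :=
  ∃ n : ℕ, ∃ x : Fin (n + 1) → ℝ, x 0 = -1 ∧ x (Fin.last n) = 1 ∧ StrictMono x ∧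
    ∀ i : Fin n, ∃ c d : ℝ, ∀ y ∈ Icc (x i.castSucc) (x i.succ), u y = c * y + d


open Topology

/-- The largest multiple of `1 / (n + 1)` that is at most `x`. -/
def gridL (n : ℕ) (x : ℝ) : ℝ := (⌊((n : ℝ) + 1) * x⌋ : ℝ) / ((n : ℝ) + 1)

/-- The slope of `g` on the grid cell of mesh `1 / (n + 1)` containing `x`. -/
def gridSlope (n : ℕ) (g : ℝ → ℝ) (x : ℝ) : ℝ :=
  ((n : ℝ) + 1) * (g (gridL n x + 1 / ((n : ℝ) + 1)) - g (gridL n x))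

/-- The piecewise linear interpolation of `g` on the grid of mesh `1 / (n + 1)`. -/
def gridInterp (n : ℕ) (g : ℝ → ℝ) (x : ℝ) : ℝ :=
  g (gridL n x) + (x - gridL n x) * gridSlope n g x

lemma gridL_le (n : ℕ) (x : ℝ) : gridL n x ≤ x := by
  have hn : (0 : ℝ) < (n : ℝ) + 1 := by positivity
  rw [gridL, div_le_iff₀ hn, mul_comm x]
  exact Int.floor_le _

lemma lt_gridL_add (n : ℕ) (x : ℝ) : x < gridL n x + 1 / ((n : ℝ) + 1) := by
  have hn : (0 : ℝ) < (n : ℝ) + 1 := by positivity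
  rw [gridL, ← add_div, lt_div_iff₀ hn, mul_comm x]
  exact Int.lt_floor_add_one _

lemma gridL_eq (n : ℕ) (j : ℤ) {x : ℝ} (h1 : (j : ℝ) / ((n : ℝ) + 1) ≤ x)
    (h2 : x < (j : ℝ) / ((n : ℝ) + 1) + 1 / ((n : ℝ) + 1)) :
    gridL n x = (j : ℝ) / ((n : ℝ) + 1) := by
  have hn : (0 : ℝ) < (n : ℝ) + 1 := by positivity
  rw [gridL]
  congr 2
  rw [Int.floor_eq_iff]
  rw [← add_div, lt_div_iff₀ hn] at h2
  rw [div_le_iff₀ hn] at h1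
  constructor <;> linarith

lemma gridL_congr (n : ℕ) {x y : ℝ} (h1 : gridL n x ≤ y)
    (h2 : y < gridL n x + 1 / ((n : ℝ) + 1)) : gridL n y = gridL n x :=
  gridL_eq n _ h1 h2

lemma tendsto_gridL (x : ℝ) : Tendsto (fun n => gridL n x) atTop (𝓝 x) := by
  have h : Tendsto (fun n : ℕ => x - 1 / ((n : ℝ) + 1)) atTop (𝓝 x) := by
    simpa using (tendsto_const_nhds (x := x)).sub tendsto_one_div_add_atTop_nhds_zero_nat
  exact tendsto_of_tendsto_of_tendsto_of_le_of_le h tendsto_const_nhds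
    (fun n => by have := lt_gridL_add n x; dsimp only; linarith) (fun n => gridL_le n x)

lemma measurable_gridL (n : ℕ) : Measurable (gridL n) := by
  unfold gridL
  fun_prop

lemma tendsto_gridSlope {g : ℝ → ℝ} {x : ℝ} (hg : DifferentiableAt ℝ g x) :
    Tendsto (fun n => gridSlope n g x) atTop (𝓝 (deriv g x)) := by
  rw [Metric.tendsto_atTop']
  intro ε hε
  have hlit := hg.hasDerivAt.isLittleO.def (half_pos hε)
  have hL := (tendsto_gridL x).eventually hlit
  have hR' : Tendsto (fun n : ℕ => gridL n x + 1 / ((n : ℝ) + 1)) atTop (𝓝 x) := by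
    simpa using (tendsto_gridL x).add tendsto_one_div_add_atTop_nhds_zero_nat
  have hR := hR'.eventually hlit
  obtain ⟨m, hm⟩ := eventually_atTop.1 (hL.and hR)
  refine ⟨m, fun n hn => ?_⟩
  obtain ⟨h1, h2⟩ := hm n hn.le
  have hlt := lt_gridL_add n x
  have hle := gridL_le n x
  rw [Real.dist_eq, gridSlope]
  have hn0 : (0 : ℝ) < (n : ℝ) + 1 := by positivity
  set d : ℝ := 1 / ((n : ℝ) + 1) with hd
  have hdn : ((n : ℝ) + 1) * d = 1 := by rw [hd]; field_simp
  set L := gridL n x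
  simp only [smul_eq_mul, Real.norm_eq_abs] at h1 h2
  rw [abs_of_nonpos (by linarith : L - x ≤ 0)] at h1
  rw [abs_of_nonneg (by linarith : 0 ≤ L + d - x)] at h2
  have key : |(g (L + d) - g L) - d * deriv g x| ≤ ε / 2 * d := by
    rw [abs_le] at h1 h2 ⊢
    constructor <;> linarith [h1.1, h1.2, h2.1, h2.2]
  have : ((n : ℝ) + 1) * (g (L + d) - g L) - deriv g x
      = ((n : ℝ) + 1) * ((g (L + d) - g L) - d * deriv g x) := by
    rw [mul_sub _ (g (L + d) - g L), ← mul_assoc, hdn, one_mul]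
  rw [this, abs_mul, abs_of_pos hn0]
  calc ((n : ℝ) + 1) * |(g (L + d) - g L) - d * deriv g x|
      ≤ ((n : ℝ) + 1) * (ε / 2 * d) := by gcongr
    _ = ε / 2 * (((n : ℝ) + 1) * d) := by ring
    _ < ε := by rw [hdn]; linarith

lemma measurable_gridSlope (n : ℕ) {g : ℝ → ℝ} (hg : Measurable g) :
    Measurable (gridSlope n g) := by
  unfold gridSlope
  have := measurable_gridL n
  fun_prop

lemma LipschitzWith.abs_sub_le {K : ℝ≥0} {g : ℝ → ℝ} (hg : LipschitzWith K g) (x y : ℝ) :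
    |g x - g y| ≤ K * |x - y| := by
  simpa [Real.dist_eq] using hg.dist_le_mul x y

lemma abs_gridSlope_le {K : ℝ≥0} {g : ℝ → ℝ} (hg : LipschitzWith K g) (n : ℕ) (x : ℝ) :
    |gridSlope n g x| ≤ K := by
  have hn : (0 : ℝ) < (n : ℝ) + 1 := by positivity
  have := hg.abs_sub_le (gridL n x + 1 / ((n : ℝ) + 1)) (gridL n x)
  rw [add_sub_cancel_left, abs_of_pos (by positivity : (0 : ℝ) < 1 / ((n : ℝ) + 1))] at this
  rw [gridSlope, abs_mul, abs_of_pos hn]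
  calc _ ≤ ((n : ℝ) + 1) * (K * (1 / ((n : ℝ) + 1))) := by gcongr
    _ = K := by field_simp

lemma gridInterp_eq_of_mem (n : ℕ) (g : ℝ → ℝ) {x y : ℝ} (h1 : gridL n x ≤ y)
    (h2 : y ≤ gridL n x + 1 / ((n : ℝ) + 1)) :
    gridInterp n g y = g (gridL n x) + (y - gridL n x) * gridSlope n g x := by
  have hn : (0 : ℝ) < (n : ℝ) + 1 := by positivity
  rcases h2.lt_or_eq with h | h
  · rw [gridInterp, gridSlope, gridL_congr n h1 h, gridSlope]
  · have hy : gridL n y = y := by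
      have e : y = ((⌊((n : ℝ) + 1) * x⌋ + 1 : ℤ) : ℝ) / ((n : ℝ) + 1) := by
        rw [h, gridL]; push_cast; ring
      have := gridL_eq n (⌊((n : ℝ) + 1) * x⌋ + 1) e.ge
        (by rw [← e]; linarith [show 0 < 1 / ((n : ℝ) + 1) by positivity])
      rw [this, ← e]
    rw [gridInterp, hy, sub_self, zero_mul, add_zero, gridSlope, ← h]
    have : (y - gridL n x) * ((n : ℝ) + 1) = 1 := by
      rw [h]; field_simp; ring
    linear_combination (g (gridL n x) - g y) * this

lemma gridInterp_nonneg (n : ℕ) {g : ℝ → ℝ} (hg : ∀ x, 0 ≤ g x) (x : ℝ) :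
    0 ≤ gridInterp n g x := by
  have hn : (0 : ℝ) < (n : ℝ) + 1 := by positivity
  have h1 := gridL_le n x
  have h2 := lt_gridL_add n x
  rw [gridInterp, gridSlope]
  set d : ℝ := 1 / ((n : ℝ) + 1) with hd
  have hdn : ((n : ℝ) + 1) * d = 1 := by rw [hd]; field_simp
  set L := gridL n x
  set t := (x - L) * ((n : ℝ) + 1) with ht
  have ht0 : 0 ≤ t := mul_nonneg (by linarith) hn.le
  have ht1 : t ≤ 1 := by
    have := mul_le_mul_of_nonneg_left (by linarith : x - L ≤ d) hn.le
    rwa [hdn, mul_comm] at this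
  have : g L + (x - L) * (((n : ℝ) + 1) * (g (L + d) - g L)) = (1 - t) * g L + t * g (L + d) := by
    rw [ht]; ring
  rw [this]
  exact add_nonneg (mul_nonneg (by linarith) (hg _)) (mul_nonneg ht0 (hg _))

lemma lipschitzWith_gridInterp {K : ℝ≥0} {g : ℝ → ℝ} (hg : LipschitzWith K g) (n : ℕ) :
    LipschitzWith K (gridInterp n g) := by
  have hn : (0 : ℝ) < (n : ℝ) + 1 := by positivity
  have main : ∀ x y, x ≤ y → |gridInterp n g x - gridInterp n g y| ≤ K * (y - x) := by
    intro x y hxy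
    have hx1 := gridL_le n x
    have hx2 := lt_gridL_add n x
    have hy1 := gridL_le n y
    have hy2 := lt_gridL_add n y
    have hsx := abs_gridSlope_le hg n x
    have hsy := abs_gridSlope_le hg n y
    by_cases hc : y < gridL n x + 1 / ((n : ℝ) + 1)
    · rw [gridInterp_eq_of_mem n g hx1 hx2.le,
        gridInterp_eq_of_mem n g (hx1.trans hxy) hc.le]
      have : g (gridL n x) + (x - gridL n x) * gridSlope n g x -
          (g (gridL n x) + (y - gridL n x) * gridSlope n g x) = gridSlope n g x * (x - y) := by
        ring
      rw [this, abs_mul, abs_sub_comm, abs_of_nonneg (sub_nonneg.2 hxy)]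
      gcongr
    · push Not at hc
      set R := gridL n x + 1 / ((n : ℝ) + 1) with hR
      have hRL : R ≤ gridL n y := by
        rw [hR, gridL, gridL, ← add_div]
        gcongr
        have : ((⌊((n : ℝ) + 1) * x⌋ + 1 : ℤ) : ℝ) / ((n : ℝ) + 1) ≤ y := by
          rw [hR, gridL, ← add_div] at hc
          exact_mod_cast hc
        rw [div_le_iff₀ hn, mul_comm y] at this
        exact_mod_cast Int.le_floor.2 this
      have e1 : gridInterp n g R = g R := by
        rw [gridInterp_eq_of_mem n g (x := x) (by linarith) hR.le, gridSlope, hR]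
        field_simp
        ring
      have b1 : |gridInterp n g x - g R| ≤ K * (R - x) := by
        rw [← e1, gridInterp_eq_of_mem n g hx1 hx2.le,
          gridInterp_eq_of_mem n g (x := x) (by linarith) hR.le]
        have : g (gridL n x) + (x - gridL n x) * gridSlope n g x -
          (g (gridL n x) + (R - gridL n x) * gridSlope n g x) = gridSlope n g x * (x - R) := by
          ring
        rw [this, abs_mul, abs_sub_comm, abs_of_nonneg (sub_nonneg.2 hx2.le)]
        gcongr
      have b2 : |g R - g (gridL n y)| ≤ K * (gridL n y - R) := by
        have := hg.abs_sub_le R (gridL n y)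
        rwa [abs_sub_comm R, abs_of_nonneg (sub_nonneg.2 hRL)] at this
      have b3 : |g (gridL n y) - gridInterp n g y| ≤ K * (y - gridL n y) := by
        rw [gridInterp, sub_add_cancel_left, abs_neg, abs_mul, mul_comm,
          abs_of_nonneg (sub_nonneg.2 hy1)]
        gcongr
      calc |gridInterp n g x - gridInterp n g y|
          = |(gridInterp n g x - g R) + (g R - g (gridL n y))
              + (g (gridL n y) - gridInterp n g y)| := by congr 1; ring
        _ ≤ K * (R - x) + K * (gridL n y - R) + K * (y - gridL n y) :=
            (abs_add_three _ _ _).trans (by gcongr)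
        _ = K * (y - x) := by ring
  refine LipschitzWith.of_dist_le_mul fun x y => ?_
  rw [Real.dist_eq, Real.dist_eq]
  rcases le_total x y with h | h
  · rw [abs_sub_comm x, abs_of_nonneg (sub_nonneg.2 h)]
    exact main x y h
  · rw [abs_of_nonneg (sub_nonneg.2 h), abs_sub_comm]
    exact main y x h

lemma abs_gridInterp_sub_le {K : ℝ≥0} {g : ℝ → ℝ} (hg : LipschitzWith K g) (n : ℕ) (x : ℝ) :
    |gridInterp n g x - g x| ≤ 2 * K * (1 / ((n : ℝ) + 1)) := by
  have h1 := gridL_le n x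
  have h2 := lt_gridL_add n x
  have b1 := hg.abs_sub_le (gridL n x) x
  rw [abs_sub_comm (gridL n x), abs_of_nonneg (sub_nonneg.2 h1)] at b1
  have b2 : |(x - gridL n x) * gridSlope n g x| ≤ (x - gridL n x) * K := by
    rw [abs_mul, abs_of_nonneg (sub_nonneg.2 h1)]
    exact mul_le_mul_of_nonneg_left (abs_gridSlope_le hg n x) (sub_nonneg.2 h1)
  calc |gridInterp n g x - g x|
      = |(g (gridL n x) - g x) + (x - gridL n x) * gridSlope n g x| := by
        rw [gridInterp]; congr 1; ring
    _ ≤ K * (x - gridL n x) + (x - gridL n x) * K := (abs_add_le _ _).trans (by gcongr)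
    _ = 2 * K * (x - gridL n x) := by ring
    _ ≤ 2 * K * (1 / ((n : ℝ) + 1)) := by gcongr; linarith

lemma tendsto_gridInterp {K : ℝ≥0} {g : ℝ → ℝ} (hg : LipschitzWith K g) (x : ℝ) :
    Tendsto (fun n => gridInterp n g x) atTop (𝓝 (g x)) := by
  rw [tendsto_iff_dist_tendsto_zero]
  refine squeeze_zero (fun _ => dist_nonneg)
    (fun n => (Real.dist_eq _ _).trans_le (abs_gridInterp_sub_le hg n x)) ?_
  simpa using (tendsto_one_div_add_atTop_nhds_zero_nat (𝕜 := ℝ)).const_mul (2 * (K : ℝ))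

lemma deriv_gridInterp (n : ℕ) (g : ℝ → ℝ) {x : ℝ} (hx : x ∉ range ((↑) : ℚ → ℝ)) :
    deriv (gridInterp n g) x = gridSlope n g x := by
  have h1 : gridL n x < x := (gridL_le n x).lt_of_ne fun h => hx
    ⟨(⌊((n : ℝ) + 1) * x⌋ : ℚ) / ((n : ℚ) + 1), by push_cast; exact h⟩
  have h2 := lt_gridL_add n x
  have : gridInterp n g =ᶠ[𝓝 x]
      fun y => g (gridL n x) + (y - gridL n x) * gridSlope n g x := by
    filter_upwards [Ioo_mem_nhds h1 h2] with y hy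
    exact gridInterp_eq_of_mem n g hy.1.le hy.2.le
  rw [this.deriv_eq]
  simp

/-- The `i`-th node of the grid of mesh `1 / (n + 1)` in `[-1, 1]`. -/
def gridNode (n i : ℕ) : ℝ := -1 + i / ((n : ℝ) + 1)

lemma gridNode_zero (n : ℕ) : gridNode n 0 = -1 := by simp [gridNode]

lemma gridNode_last (n : ℕ) : gridNode n (2 * (n + 1)) = 1 := by
  rw [gridNode]; push_cast; field_simp; ring

lemma gridNode_succ (n i : ℕ) : gridNode n (i + 1) = gridNode n i + 1 / ((n : ℝ) + 1) := by
  rw [gridNode, gridNode]; push_cast; ring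

lemma gridL_eq_gridNode (n i : ℕ) {x : ℝ} (h1 : gridNode n i ≤ x) (h2 : x < gridNode n (i + 1)) :
    gridL n x = gridNode n i := by
  have hn : (0 : ℝ) < (n : ℝ) + 1 := by positivity
  have e : gridNode n i = (((i : ℤ) - (n + 1) : ℤ) : ℝ) / ((n : ℝ) + 1) := by
    rw [gridNode]; push_cast; field_simp; ring
  rw [gridNode_succ] at h2
  rw [e] at h1 h2 ⊢
  exact gridL_eq n _ h1 h2

lemma strictMono_gridNode (n : ℕ) : StrictMono (gridNode n) :=
  strictMono_nat_of_lt_succ fun i => by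
    rw [gridNode_succ]; linarith [show 0 < 1 / ((n : ℝ) + 1) by positivity]

lemma gridNode_mem (n : ℕ) {i : ℕ} (hi : i ≤ 2 * (n + 1)) : gridNode n i ∈ Icc (-1 : ℝ) 1 := by
  rw [← gridNode_zero n, mem_Icc]
  refine ⟨(strictMono_gridNode n).monotone (Nat.zero_le i), ?_⟩
  exact ((strictMono_gridNode n).monotone hi).trans_eq (gridNode_last n)

lemma piecewiseLinear_gridInterp (n : ℕ) (g : ℝ → ℝ) : PiecewiseLinear (gridInterp n g) := by
  refine ⟨2 * (n + 1), fun i => gridNode n i, gridNode_zero n, gridNode_last n,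
    fun i j hij => strictMono_gridNode n hij, fun i => ?_⟩
  have e := gridL_eq_gridNode n i le_rfl (strictMono_gridNode n (Nat.lt_succ_self i))
  refine ⟨gridSlope n g (gridNode n i),
    g (gridNode n i) - gridNode n i * gridSlope n g (gridNode n i), fun y hy => ?_⟩
  simp only [Fin.val_castSucc, Fin.val_succ, gridNode_succ] at hy
  rw [gridInterp_eq_of_mem n g (x := gridNode n i) (by rw [e]; exact hy.1) (by rw [e]; exact hy.2),
    e]
  ring

lemma intervalIntegrable_comp_of_bounded {f : ℝ × ℝ × ℝ → ℝ} (hf : Continuous f)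
    {P : ℝ → ℝ × ℝ × ℝ} (hP : Measurable P) {R : ℝ} (hR : ∀ x ∈ Icc (-1 : ℝ) 1, ‖P x‖ ≤ R)
    {a b : ℝ} (ha : a ∈ Icc (-1 : ℝ) 1) (hb : b ∈ Icc (-1 : ℝ) 1) :
    IntervalIntegrable (fun x => f (P x)) volume a b := by
  obtain ⟨C, hC⟩ := (isCompact_closedBall (0 : ℝ × ℝ × ℝ) R).exists_bound_of_continuousOn
    hf.continuousOn
  refine IntervalIntegrable.mono_fun' (g := fun _ => C) intervalIntegrable_const
    (hf.measurable.comp hP).aestronglyMeasurable ?_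
  filter_upwards [ae_restrict_mem measurableSet_uIoc] with x hx
  exact hC _ (mem_closedBall_zero_iff.2
    (hR x (uIcc_subset_Icc ha hb (uIoc_subset_uIcc hx))))

lemma tendsto_integral_comp_of_bounded {f : ℝ × ℝ × ℝ → ℝ} (hf : Continuous f)
    {P : ℕ → ℝ → ℝ × ℝ × ℝ} {Q : ℝ → ℝ × ℝ × ℝ} (hP : ∀ n, Measurable (P n)) {R : ℝ}
    (hR : ∀ n, ∀ x ∈ Icc (-1 : ℝ) 1, ‖P n x‖ ≤ R)
    (hlim : ∀ᵐ x, Tendsto (fun n => P n x) atTop (𝓝 (Q x))) :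
    Tendsto (fun n => ∫ x in (-1 : ℝ)..1, f (P n x)) atTop
      (𝓝 (∫ x in (-1 : ℝ)..1, f (Q x))) := by
  obtain ⟨C, hC⟩ := (isCompact_closedBall (0 : ℝ × ℝ × ℝ) R).exists_bound_of_continuousOn
    hf.continuousOn
  refine intervalIntegral.tendsto_integral_filter_of_dominated_convergence (fun _ => C)
    (.of_forall fun n => (hf.measurable.comp (hP n)).aestronglyMeasurable)
    (.of_forall fun n => .of_forall fun x hx => ?_) intervalIntegrable_const ?_
  · rw [uIoc_of_le (by norm_num)] at hx
    exact hC _ (mem_closedBall_zero_iff.2 (hR n x (Ioc_subset_Icc_self hx)))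
  · filter_upwards [hlim] with x hx _
    exact (hf.tendsto _).comp hx

/-- The integral functional with Lagrangian `f` on `[-1, 1]`. -/
def lagr (f : ℝ × ℝ × ℝ → ℝ) (g : ℝ → ℝ) : ℝ := ∫ x in (-1 : ℝ)..1, f (x, g x, deriv g x)

/-- The discretization of `lagr f g` on the grid of mesh `1 / (n + 1)`. -/
def gridSum (f : ℝ × ℝ × ℝ → ℝ) (n : ℕ) (g : ℝ → ℝ) : ℝ :=
  ∑ i ∈ Finset.range (2 * (n + 1)), 1 / ((n : ℝ) + 1) *
    f (gridNode n i, g (gridNode n i),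
      ((n : ℝ) + 1) * (g (gridNode n (i + 1)) - g (gridNode n i)))

lemma norm_triple_le {a b c R : ℝ} (ha : |a| ≤ R) (hb : |b| ≤ R) (hc : |c| ≤ R) :
    ‖((a, b, c) : ℝ × ℝ × ℝ)‖ ≤ R := by
  simp only [Prod.norm_def, Real.norm_eq_abs, sup_le_iff]
  exact ⟨ha, hb, hc⟩

lemma LipschitzWith.abs_deriv_le {K : ℝ≥0} {g : ℝ → ℝ} (hg : LipschitzWith K g) (x : ℝ) :
    |deriv g x| ≤ K := norm_deriv_le_of_lipschitz hg

lemma gridL_mem (n : ℕ) {x : ℝ} (hx : x ∈ Icc (-1 : ℝ) 1) : gridL n x ∈ Icc (-1 : ℝ) 1 := by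
  have hn : (0 : ℝ) < (n : ℝ) + 1 := by positivity
  refine ⟨?_, (gridL_le n x).trans hx.2⟩
  rw [gridL, le_div_iff₀ hn]
  have : (-(n + 1) : ℤ) ≤ ⌊((n : ℝ) + 1) * x⌋ := by
    rw [Int.le_floor]
    push_cast
    nlinarith [hx.1]
  have h : ((-(n + 1) : ℤ) : ℝ) ≤ ⌊((n : ℝ) + 1) * x⌋ := by exact_mod_cast this
  push_cast at h
  linarith

lemma LipschitzWith.abs_le_of_mem {K : ℝ≥0} {g : ℝ → ℝ} (hg : LipschitzWith K g) {x : ℝ}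
    (hx : x ∈ Icc (-1 : ℝ) 1) : |g x| ≤ |g 0| + K := by
  have h1 := hg.abs_sub_le x 0
  have h2 : |x| ≤ 1 := abs_le.2 hx
  have h3 : (K : ℝ) * |x - 0| ≤ K * 1 := by rw [sub_zero]; gcongr
  have h4 := abs_sub_abs_le_abs_sub (g x) (g 0)
  linarith

lemma gridSum_eq_integral {f : ℝ × ℝ × ℝ → ℝ} (hf : Continuous f) {K : ℝ≥0} {g : ℝ → ℝ}
    (hg : LipschitzWith K g) (n : ℕ) :
    gridSum f n g = ∫ x in (-1 : ℝ)..1, f (gridL n x, g (gridL n x), gridSlope n g x) := by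
  have hm : Measurable fun x => (gridL n x, g (gridL n x), gridSlope n g x) :=
    (measurable_gridL n).prodMk ((hg.continuous.measurable.comp (measurable_gridL n)).prodMk
      (measurable_gridSlope n hg.continuous.measurable))
  have hb : ∀ x ∈ Icc (-1 : ℝ) 1, ‖(gridL n x, g (gridL n x), gridSlope n g x)‖
      ≤ 1 + |g 0| + K := fun x hx => by
    have h1 := abs_le.2 (gridL_mem n hx)
    have h2 := hg.abs_le_of_mem (gridL_mem n hx)
    have h3 := abs_gridSlope_le hg n x
    have h4 := abs_nonneg (g 0)
    have h5 := K.coe_nonneg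
    exact norm_triple_le (by linarith) (by linarith) (by linarith)
  have hadj := intervalIntegral.sum_integral_adjacent_intervals (μ := volume) (a := gridNode n)
    (n := 2 * (n + 1)) (f := fun x => f (gridL n x, g (gridL n x), gridSlope n g x))
    fun k hk => intervalIntegrable_comp_of_bounded hf hm hb (gridNode_mem n hk.le)
      (gridNode_mem n hk)
  rw [gridNode_zero, gridNode_last] at hadj
  rw [← hadj, gridSum]
  refine Finset.sum_congr rfl fun i _ => ?_
  have hlt := strictMono_gridNode n (Nat.lt_succ_self i)
  have : ∫ x in gridNode n i..gridNode n (i + 1),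
      f (gridL n x, g (gridL n x), gridSlope n g x) = ∫ x in gridNode n i..gridNode n (i + 1),
      f (gridNode n i, g (gridNode n i),
        ((n : ℝ) + 1) * (g (gridNode n (i + 1)) - g (gridNode n i))) := by
    refine intervalIntegral.integral_congr_Ioo_of_le hlt.le fun x hx => ?_
    rw [gridSlope, gridL_eq_gridNode n i hx.1.le hx.2, gridNode_succ]
  rw [this, intervalIntegral.integral_const, gridNode_succ, add_sub_cancel_left, smul_eq_mul]

lemma tendsto_gridSum {f : ℝ × ℝ × ℝ → ℝ} (hf : Continuous f) {K : ℝ≥0} {g : ℝ → ℝ}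
    (hg : LipschitzWith K g) :
    Tendsto (fun n => gridSum f n g) atTop (𝓝 (lagr f g)) := by
  simp only [gridSum_eq_integral hf hg]
  refine tendsto_integral_comp_of_bounded hf (R := 1 + |g 0| + K) (fun n => ?_)
    (fun n x hx => ?_) ?_
  · exact (measurable_gridL n).prodMk ((hg.continuous.measurable.comp
      (measurable_gridL n)).prodMk (measurable_gridSlope n hg.continuous.measurable))
  · have h1 := abs_le.2 (gridL_mem n hx)
    have h2 := hg.abs_le_of_mem (gridL_mem n hx)
    have h3 := abs_gridSlope_le hg n x
    have h4 := abs_nonneg (g 0)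
    have h5 := K.coe_nonneg
    exact norm_triple_le (by linarith) (by linarith) (by linarith)
  · filter_upwards [hg.ae_differentiableAt_real] with x hx
    exact (tendsto_gridL x).prodMk_nhds
      (((hg.continuous.tendsto x).comp (tendsto_gridL x)).prodMk_nhds (tendsto_gridSlope hx))

lemma tendsto_lagr_gridInterp {f : ℝ × ℝ × ℝ → ℝ} (hf : Continuous f) {K : ℝ≥0} {g : ℝ → ℝ}
    (hg : LipschitzWith K g) :
    Tendsto (fun n => lagr f (gridInterp n g)) atTop (𝓝 (lagr f g)) := by
  refine tendsto_integral_comp_of_bounded hf (R := 1 + |g 0| + 3 * K) (fun n => ?_)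
    (fun n x hx => ?_) ?_
  · exact measurable_id.prodMk
      ((lipschitzWith_gridInterp hg n).continuous.measurable.prodMk (measurable_deriv _))
  · have h1 : |x| ≤ 1 := abs_le.2 hx
    have h2 := (lipschitzWith_gridInterp hg n).abs_le_of_mem hx
    have h3 := (lipschitzWith_gridInterp hg n).abs_deriv_le x
    have h4 := abs_nonneg (g 0)
    have h5 := K.coe_nonneg
    have h6 := abs_sub_abs_le_abs_sub (gridInterp n g 0) (g 0)
    have h7 := abs_gridInterp_sub_le hg n 0
    have h8 : 2 * K * (1 / ((n : ℝ) + 1)) ≤ 2 * K * 1 := by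
      gcongr
      rw [div_le_one (by positivity)]
      linarith [n.cast_nonneg (α := ℝ)]
    exact norm_triple_le (by linarith) (by linarith) (by linarith)
  · have hQ : ∀ᵐ x : ℝ, x ∉ range ((↑) : ℚ → ℝ) :=
      measure_eq_zero_iff_ae_notMem.1 ((countable_range _).measure_zero _)
    filter_upwards [hg.ae_differentiableAt_real, hQ] with x hx hxQ
    refine tendsto_const_nhds.prodMk_nhds ((tendsto_gridInterp hg x).prodMk_nhds ?_)
    simp only [deriv_gridInterp _ g hxQ]
    exact tendsto_gridSlope hx

open scoped Interval in
lemma jensen_slope {φ : ℝ → ℝ} (hφ : ConvexOn ℝ univ φ) (hc : Continuous φ) {K : ℝ≥0}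
    {g : ℝ → ℝ} (hg : LipschitzWith K g) {a b : ℝ} (hab : a < b)
    (hi : IntervalIntegrable (fun y => φ (deriv g y)) volume a b) :
    (b - a) * φ ((b - a)⁻¹ * (g b - g a)) ≤ ∫ y in a..b, φ (deriv g y) := by
  have hac := (hg.lipschitzOnWith (s := uIcc a b)).absolutelyContinuousOnInterval
  have hd : IntervalIntegrable (deriv g) volume a b := hac.intervalIntegrable_deriv
  have h0 : 0 < b - a := sub_pos.2 hab
  have := hφ.map_set_average_le (μ := volume) (t := Ι a b) (f := deriv g) hc.continuousOn
    isClosed_univ (by simp [uIoc_of_le hab.le, hab]) (by simp [uIoc_of_le hab.le])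
    (by simp) (intervalIntegrable_iff.1 hd) (intervalIntegrable_iff.1 hi)
  rw [interval_average_eq, hac.integral_deriv_eq_sub, smul_eq_mul] at this
  have h2 : ⨍ x in Ι a b, φ (deriv g x) = (b - a)⁻¹ • ∫ x in a..b, φ (deriv g x) :=
    interval_average_eq _ a b
  rw [h2, smul_eq_mul] at this
  calc _ ≤ (b - a) * ((b - a)⁻¹ * ∫ x in a..b, φ (deriv g x)) := by gcongr
    _ = _ := by field_simp

lemma eventually_gridSum_le {f : ℝ × ℝ × ℝ → ℝ} (hf : Continuous f)
    (hconv : ∀ x v, ConvexOn ℝ univ fun p => f (x, v, p)) (K : ℝ≥0) (M : ℝ) {ε : ℝ} (hε : 0 < ε) :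
    ∀ᶠ n in atTop, ∀ g : ℝ → ℝ, LipschitzWith K g → |g 0| ≤ M →
      gridSum f n g ≤ lagr f g + ε := by
  have huc := (isCompact_closedBall (0 : ℝ × ℝ × ℝ) (1 + M + K)).uniformContinuousOn_of_continuous
    hf.continuousOn
  obtain ⟨δ, hδ, hfδ⟩ := Metric.uniformContinuousOn_iff.1 huc (ε / 2) (by positivity)
  have hlim : Tendsto (fun n : ℕ => (1 + K : ℝ) * (1 / ((n : ℝ) + 1))) atTop (𝓝 0) := by
    simpa using (tendsto_one_div_add_atTop_nhds_zero_nat (𝕜 := ℝ)).const_mul (1 + K : ℝ)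
  filter_upwards [hlim.eventually_lt_const hδ] with n hn g hg hgM
  have hn0 : (0 : ℝ) < (n : ℝ) + 1 := by positivity
  have hd0 : 0 < 1 / ((n : ℝ) + 1) := by positivity
  have hM : 0 ≤ M := (abs_nonneg _).trans hgM
  have hK := K.coe_nonneg
  have hball : ∀ x ∈ Icc (-1 : ℝ) 1, ∀ p : ℝ, |p| ≤ K → ‖(x, g x, p)‖ ≤ 1 + M + K := by
    intro x hx p hp
    have h1 : |x| ≤ 1 := abs_le.2 hx
    have h2 := hg.abs_le_of_mem hx
    exact norm_triple_le (by linarith) (by linarith) (by linarith)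
  have hm : Measurable fun x => (x, g x, deriv g x) :=
    measurable_id.prodMk (hg.continuous.measurable.prodMk (measurable_deriv _))
  have hint : ∀ a ∈ Icc (-1 : ℝ) 1, ∀ b ∈ Icc (-1 : ℝ) 1,
      IntervalIntegrable (fun x => f (x, g x, deriv g x) + ε / 2) volume a b := fun a ha b hb =>
    (intervalIntegrable_comp_of_bounded hf hm (fun x hx => hball x hx _ (hg.abs_deriv_le x))
      ha hb).add intervalIntegrable_const
  have hadj := intervalIntegral.sum_integral_adjacent_intervals (μ := volume) (a := gridNode n)
    (n := 2 * (n + 1)) (f := fun x => f (x, g x, deriv g x) + ε / 2)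
    fun k hk => hint _ (gridNode_mem n hk.le) _ (gridNode_mem n hk)
  have hL : lagr f g + ε = ∫ x in (-1 : ℝ)..1, (f (x, g x, deriv g x) + ε / 2) := by
    rw [intervalIntegral.integral_add (intervalIntegrable_comp_of_bounded hf hm
      (fun x hx => hball x hx _ (hg.abs_deriv_le x)) (by simp) (by simp)) intervalIntegrable_const,
      intervalIntegral.integral_const, lagr, smul_eq_mul]
    ring
  rw [gridNode_zero, gridNode_last] at hadj
  rw [hL, ← hadj, gridSum]
  refine Finset.sum_le_sum fun i hi => ?_
  have hi' : i < 2 * (n + 1) := Finset.mem_range.1 hi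
  have hlt := strictMono_gridNode n (Nat.lt_succ_self i)
  have hsub : gridNode n (i + 1) - gridNode n i = 1 / ((n : ℝ) + 1) := by
    rw [gridNode_succ]; ring
  have hmem := gridNode_mem n hi'.le
  have hi1 : IntervalIntegrable (fun y => f (gridNode n i, g (gridNode n i), deriv g y)) volume
      (gridNode n i) (gridNode n (i + 1)) :=
    intervalIntegrable_comp_of_bounded hf
      (P := fun y => (gridNode n i, g (gridNode n i), deriv g y))
      (measurable_const.prodMk (measurable_const.prodMk (measurable_deriv _)))
      (fun x _ => hball _ hmem _ (hg.abs_deriv_le x)) hmem (gridNode_mem n hi')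
  have hJ := jensen_slope (hconv (gridNode n i) (g (gridNode n i))) (by fun_prop) hg hlt hi1
  rw [hsub, one_div, inv_inv, ← one_div] at hJ
  refine hJ.trans (intervalIntegral.integral_mono_on hlt.le hi1
    (hint _ hmem _ (gridNode_mem n hi')) fun y hy => ?_)
  have hyI : y ∈ Icc (-1 : ℝ) 1 := ⟨hmem.1.trans hy.1, hy.2.trans (gridNode_mem n hi').2⟩
  have hdist : |gridNode n i - y| ≤ 1 / ((n : ℝ) + 1) := by
    rw [abs_sub_comm, abs_of_nonneg (sub_nonneg.2 hy.1), ← hsub]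
    linarith [hy.2]
  have := hfδ (gridNode n i, g (gridNode n i), deriv g y)
    (mem_closedBall_zero_iff.2 (hball _ hmem _ (hg.abs_deriv_le y))) (y, g y, deriv g y)
    (mem_closedBall_zero_iff.2 (hball _ hyI _ (hg.abs_deriv_le y))) ?_
  · rw [Real.dist_eq] at this
    linarith [(abs_lt.1 this).2]
  · refine lt_of_le_of_lt ?_ hn
    rw [dist_eq_norm]
    have h2 := hg.abs_sub_le (gridNode n i) y
    have h3 : (K : ℝ) * |gridNode n i - y| ≤ K * (1 / ((n : ℝ) + 1)) := by gcongr
    have h4 : 0 ≤ (K : ℝ) * (1 / ((n : ℝ) + 1)) := by positivity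
    refine norm_triple_le ?_ ?_ ?_
    · linarith
    · linarith
    · simp only [sub_self, abs_zero]
      linarith

/-- Lower semicontinuity of `lagr f` along pointwise limits of equi-Lipschitz functions. -/
lemma lagr_le_of_tendsto {f : ℝ × ℝ × ℝ → ℝ} (hf : Continuous f)
    (hconv : ∀ x v, ConvexOn ℝ univ fun p => f (x, v, p)) {K : ℝ≥0} {M : ℝ}
    {G : ℕ → ℝ → ℝ} {g : ℝ → ℝ} (hG : ∀ k, LipschitzWith K (G k)) (hGM : ∀ k, |G k 0| ≤ M)
    (hg : LipschitzWith K g)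
    (hlim : ∀ x ∈ Icc (-1 : ℝ) 1, Tendsto (fun k => G k x) atTop (𝓝 (g x)))
    {c : ℕ → ℝ} {C : ℝ} (hc : ∀ k, lagr f (G k) ≤ c k) (hcC : Tendsto c atTop (𝓝 C)) :
    lagr f g ≤ C := by
  refine le_of_forall_pos_le_add fun ε hε => ?_
  refine le_of_tendsto (tendsto_gridSum hf hg) ?_
  filter_upwards [eventually_gridSum_le hf hconv K M hε] with n hn
  have h1 : Tendsto (fun k => gridSum f n (G k)) atTop (𝓝 (gridSum f n g)) := by
    refine tendsto_finsetSum _ fun i hi => ?_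
    have hi' : i < 2 * (n + 1) := Finset.mem_range.1 hi
    have l1 := hlim _ (gridNode_mem n hi'.le)
    have l2 := hlim _ (gridNode_mem n hi')
    exact ((hf.tendsto _).comp (tendsto_const_nhds.prodMk_nhds
      (l1.prodMk_nhds ((l2.sub l1).const_mul _)))).const_mul _
  exact le_of_tendsto_of_tendsto' h1 (hcC.add_const ε) fun k =>
    (hn (G k) (hG k) (hGM k)).trans (by gcongr; exact hc k)

/-- The measure of the superlevel set `{u > t}` in `[-1, 1]`. -/
def superMeas (u : ℝ → ℝ) (t : ℝ) : ℝ := volume.real {y ∈ Icc (-1 : ℝ) 1 | u y > t}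

lemma volume_Icc_sep_ne_top (p : ℝ → Prop) : volume {y ∈ Icc (-1 : ℝ) 1 | p y} ≠ ∞ :=
  measure_ne_top_of_subset (sep_subset _ _) measure_Icc_lt_top.ne

lemma antitone_superMeas (u : ℝ → ℝ) : Antitone (superMeas u) := fun _ _ h =>
  measureReal_mono (fun _ hy => ⟨hy.1, h.trans_lt hy.2⟩) (volume_Icc_sep_ne_top _)

lemma mrear_eq (u : ℝ → ℝ) {x : ℝ} (hx : x ≤ 1) :
    mrear u x = volume.real ({t | 1 - x ≤ superMeas u t} ∩ Ioi 0) := by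
  have hm : MeasurableSet {t | 1 - x ≤ superMeas u t} :=
    measurableSet_le measurable_const (antitone_superMeas u).measurable
  rw [← measureReal_restrict_apply hm, ← integral_indicator_one hm, mrear]
  refine integral_congr_ae (.of_forall fun t => ?_)
  simp only [indicator, mem_Icc, hx, and_true, mem_ofPred_eq, superMeas, measureReal_def,
    Pi.one_apply, sub_le_comm]

lemma mrear_nonneg (u : ℝ → ℝ) {x : ℝ} (hx : x ≤ 1) : 0 ≤ mrear u x := by
  rw [mrear_eq u hx]; exact measureReal_nonneg

lemma superMeas_eq_zero {u : ℝ → ℝ} {M : ℝ} (hu : ∀ y ∈ Icc (-1 : ℝ) 1, u y ≤ M) {t : ℝ}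
    (ht : M ≤ t) : superMeas u t = 0 := by
  rw [superMeas, measureReal_def]
  have : {y ∈ Icc (-1 : ℝ) 1 | u y > t} = ∅ := by
    ext y
    simp only [mem_ofPred_eq, mem_empty_iff_false, iff_false, not_and, not_lt, gt_iff_lt]
    exact fun hy => (hu y hy).trans ht
  rw [this]
  simp

lemma le_superMeas_of_lt_mrear {u : ℝ → ℝ} {x c : ℝ} (hx : x ≤ 1) (hc : 0 ≤ c)
    (h : c < mrear u x) : 1 - x ≤ superMeas u c := by
  by_contra! hlt
  rw [mrear_eq u hx] at h
  have hsub : {t | 1 - x ≤ superMeas u t} ∩ Ioi 0 ⊆ Ioc 0 c := by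
    rintro t ⟨ht1, ht2⟩
    refine ⟨ht2, ?_⟩
    by_contra! hct
    exact absurd (antitone_superMeas u hct.le) (not_le.2 (hlt.trans_le ht1))
  have := measureReal_mono (μ := volume) hsub measure_Ioc_lt_top.ne
  rw [Real.volume_real_Ioc_of_le hc] at this
  linarith

lemma le_mrear_of_le_superMeas {u : ℝ → ℝ} {M : ℝ} (hu : ∀ y ∈ Icc (-1 : ℝ) 1, u y ≤ M)
    {x c : ℝ} (hx : x < 1) (h : 1 - x ≤ superMeas u c) : c ≤ mrear u x := by
  rcases lt_or_ge c 0 with hc | hc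
  · exact hc.le.trans (mrear_nonneg u hx.le)
  rw [mrear_eq u hx.le]
  have hfin : volume ({t | 1 - x ≤ superMeas u t} ∩ Ioi 0) ≠ ∞ := by
    refine measure_ne_top_of_subset (?_ : _ ⊆ Ioc 0 M) measure_Ioc_lt_top.ne
    rintro t ⟨ht1, ht2⟩
    refine ⟨ht2, ?_⟩
    by_contra! hMt
    have : (1 : ℝ) - x ≤ superMeas u t := ht1
    rw [superMeas_eq_zero hu hMt.le] at this
    linarith
  have hsub : Ioc 0 c ⊆ {t | 1 - x ≤ superMeas u t} ∩ Ioi 0 := fun t ht =>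
    ⟨h.trans (antitone_superMeas u ht.2), ht.1⟩
  have := measureReal_mono (μ := volume) hsub hfin
  rwa [Real.volume_real_Ioc_of_le hc, sub_zero] at this

lemma mrear_le_add {v w : ℝ → ℝ} {M : ℝ} (hw : ∀ y ∈ Icc (-1 : ℝ) 1, w y ≤ M) {ε : ℝ}
    (hε : 0 ≤ ε) (h : ∀ y ∈ Icc (-1 : ℝ) 1, v y ≤ w y + ε) {x : ℝ} (hx : x < 1) :
    mrear v x ≤ mrear w x + ε := by
  by_contra! hlt
  obtain ⟨c, hc1, hc2⟩ := exists_between hlt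
  have hw0 := mrear_nonneg w hx.le
  have h1 := le_superMeas_of_lt_mrear hx.le (by linarith) hc2
  have h2 : superMeas v c ≤ superMeas w (c - ε) :=
    measureReal_mono (fun y hy => ⟨hy.1, sub_lt_iff_lt_add.2 (hy.2.trans_le (h y hy.1))⟩)
      (volume_Icc_sep_ne_top _)
  have h3 := le_mrear_of_le_superMeas hw hx (h1.trans h2)
  linarith

lemma mrear_mono {u : ℝ → ℝ} {M : ℝ} (hu : ∀ y ∈ Icc (-1 : ℝ) 1, u y ≤ M) {x y : ℝ}
    (hxy : x ≤ y) (hy : y < 1) : mrear u x ≤ mrear u y := by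
  refine le_of_forall_lt fun c hc => ?_
  obtain ⟨d, hcd, hd⟩ := exists_between hc
  rcases lt_or_ge d 0 with h0 | h0
  · exact (hcd.trans h0).trans_le (mrear_nonneg u hy.le)
  refine hcd.trans_le (le_mrear_of_le_superMeas hu hy ?_)
  have := le_superMeas_of_lt_mrear (hxy.trans hy.le) h0 hd
  linarith

/-- A continuous function must spend length at least `(t - s) / K` between two of its levels
`s < t` when it is `K`-Lipschitz. -/
lemma sub_le_mul_superMeas_sub {K : ℝ≥0} {u : ℝ → ℝ} (hu : LipschitzWith K u) {s t : ℝ}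
    (hst : s < t) (hs : superMeas u s < 2) (ht : 0 < superMeas u t) :
    t - s ≤ K * (superMeas u s - superMeas u t) := by
  obtain ⟨p, hpI, hp⟩ : ∃ p ∈ Icc (-1 : ℝ) 1, u p ≤ s := by
    by_contra! hall
    have : {y ∈ Icc (-1 : ℝ) 1 | u y > s} = Icc (-1) 1 := by
      ext y
      exact ⟨fun h => h.1, fun h => ⟨h, hall y h⟩⟩
    rw [superMeas, this, Real.volume_real_Icc_of_le (by norm_num)] at hs
    norm_num at hs
  obtain ⟨q, hqI, hq⟩ : ∃ q ∈ Icc (-1 : ℝ) 1, t < u q := by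
    by_contra! hall
    rw [superMeas_eq_zero hall le_rfl] at ht
    exact lt_irrefl _ ht
  set S : Set ℝ := {y ∈ Icc (-1 : ℝ) 1 | u y > s} \ {y ∈ Icc (-1 : ℝ) 1 | u y > t} with hS
  have hmeas : MeasurableSet {y ∈ Icc (-1 : ℝ) 1 | u y > t} :=
    measurableSet_Icc.inter (measurableSet_lt measurable_const hu.continuous.measurable)
  have hSreal : volume.real S = superMeas u s - superMeas u t :=
    measureReal_sdiff (fun y hy => ⟨hy.1, hst.trans hy.2⟩) hmeas (volume_Icc_sep_ne_top _)
  have himg : Ioc s t ⊆ u '' S := by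
    intro c hc
    obtain ⟨y, hy, rfl⟩ := (isPreconnected_Icc (a := (-1 : ℝ)) (b := 1)).intermediate_value
      hpI hqI hu.continuous.continuousOn ⟨hp.trans hc.1.le, hc.2.trans hq.le⟩
    exact ⟨y, ⟨⟨hy, hc.1⟩, fun h => absurd h.2 (not_lt.2 hc.2)⟩, rfl⟩
  have hvol : volume (u '' S) ≤ K * volume S := by
    have := hu.hausdorffMeasure_image_le zero_le_one S
    simpa [hausdorffMeasure_real] using this
  have hSfin : volume S ≠ ∞ :=
    measure_ne_top_of_subset sdiff_subset (volume_Icc_sep_ne_top _)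
  have h1 : ENNReal.ofReal (t - s) ≤ K * volume S := by
    rw [← Real.volume_Ioc]
    exact (measure_mono himg).trans hvol
  have h2 := ENNReal.toReal_mono (ENNReal.mul_ne_top ENNReal.coe_ne_top hSfin) h1
  rwa [ENNReal.toReal_ofReal (sub_nonneg.2 hst.le), ENNReal.toReal_mul, ENNReal.coe_toReal,
    ← measureReal_def, hSreal] at h2

lemma lipschitzOnWith_mrear {K : ℝ≥0} {u : ℝ → ℝ} (hu : LipschitzWith K u) :
    LipschitzOnWith K (mrear u) (Ico (-1) 1) := by
  have hM : ∀ y ∈ Icc (-1 : ℝ) 1, u y ≤ |u 0| + K := fun y hy =>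
    (le_abs_self _).trans (hu.abs_le_of_mem hy)
  have main : ∀ x y, -1 ≤ x → x ≤ y → y < 1 → |mrear u x - mrear u y| ≤ K * (y - x) := by
    intro x y hx hxy hy
    rw [abs_sub_comm, abs_of_nonneg (sub_nonneg.2 (mrear_mono hM hxy hy))]
    by_contra! hlt
    set η := (mrear u y - mrear u x - K * (y - x)) / 3 with hη
    have hη0 : 0 < η := by rw [hη]; linarith
    have hx0 := mrear_nonneg u (hxy.trans hy.le)
    have hK : 0 ≤ K * (y - x) := mul_nonneg K.coe_nonneg (sub_nonneg.2 hxy)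
    have h1 : 1 - y ≤ superMeas u (mrear u y - η) :=
      le_superMeas_of_lt_mrear hy.le (by linarith) (by linarith)
    have h2 : superMeas u (mrear u x + η) < 1 - x := by
      by_contra! h
      linarith [le_mrear_of_le_superMeas hM (hxy.trans_lt hy) h]
    have h3 := sub_le_mul_superMeas_sub hu (s := mrear u x + η) (t := mrear u y - η)
      (by linarith) (by linarith) (by linarith)
    have h4 : K * (superMeas u (mrear u x + η) - superMeas u (mrear u y - η)) ≤ K * (y - x) :=
      mul_le_mul_of_nonneg_left (by linarith) K.coe_nonneg
    linarith
  refine LipschitzOnWith.of_dist_le_mul fun x hx y hy => ?_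
  rw [Real.dist_eq, Real.dist_eq]
  rcases le_total x y with h | h
  · rw [abs_sub_comm x, abs_of_nonneg (sub_nonneg.2 h)]
    exact main x y hx.1 h hy.2
  · rw [abs_of_nonneg (sub_nonneg.2 h), abs_sub_comm]
    exact main y x hy.1 h hx.2

lemma mrear_congr {u v : ℝ → ℝ} (h : EqOn u v (Icc (-1) 1)) : mrear u = mrear v := by
  have : ∀ t, {y ∈ Icc (-1 : ℝ) 1 | u y > t} = {y ∈ Icc (-1 : ℝ) 1 | v y > t} := fun t => by
    ext y
    simp only [mem_ofPred_eq]
    exact and_congr_right fun hy => by rw [h hy]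
  funext x
  simp only [mrear, this]

/-- The Lagrangian of `Ifun F a`, extended to all of `ℝ × ℝ × ℝ`. -/
def lagrangian (F a : ℝ → ℝ → ℝ) (p : ℝ × ℝ × ℝ) : ℝ :=
  F (max p.2.1 0) (a (max (-1) (min 1 p.1)) (max p.2.1 0) * |p.2.2|)

lemma clamp_mem (x : ℝ) : max (-1) (min 1 x) ∈ Icc (-1 : ℝ) 1 :=
  ⟨le_max_left _ _, max_le (by norm_num) (min_le_left _ _)⟩

section

variable {F a : ℝ → ℝ → ℝ}

lemma weight_mul_abs_nonneg (ha : Weight a) (x v p : ℝ) :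
    0 ≤ a (max (-1) (min 1 x)) (max v 0) * |p| :=
  mul_nonneg (ha.2 _ _ (clamp_mem x) (le_max_right _ _)) (abs_nonneg p)

lemma continuous_lagrangian (ha : Weight a) (hF : MemFrakF F) : Continuous (lagrangian F a) := by
  have h1 : Continuous fun p : ℝ × ℝ × ℝ => a (max (-1) (min 1 p.1)) (max p.2.1 0) :=
    ha.1.comp_continuous (f := fun p : ℝ × ℝ × ℝ => (max (-1) (min 1 p.1), max p.2.1 0))
      (by fun_prop) fun p => ⟨clamp_mem p.1, le_max_right p.2.1 0⟩
  have h2 : Continuous fun p : ℝ × ℝ × ℝ =>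
      (max p.2.1 0, a (max (-1) (min 1 p.1)) (max p.2.1 0) * |p.2.2|) :=
    (by fun_prop : Continuous fun p : ℝ × ℝ × ℝ => max p.2.1 0).prodMk
      (h1.mul (by fun_prop : Continuous fun p : ℝ × ℝ × ℝ => |p.2.2|))
  exact hF.1.comp_continuous h2 fun p => ⟨le_max_right p.2.1 0, weight_mul_abs_nonneg ha _ _ _⟩

lemma lagrangian_nonneg (ha : Weight a) (hF : MemFrakF F) (p : ℝ × ℝ × ℝ) :
    0 ≤ lagrangian F a p :=
  hF.2.1 _ _ (le_max_right _ _) (weight_mul_abs_nonneg ha _ _ _)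

lemma convexOn_lagrangian (ha : Weight a) (hF : MemFrakF F) (x v : ℝ) :
    ConvexOn ℝ univ fun p => lagrangian F a (x, v, p) := by
  have hc := ha.2 _ _ (clamp_mem x) (le_max_right v 0)
  have hv := le_max_right v 0
  refine ⟨convex_univ, fun p _ q _ s t hs ht hst => ?_⟩
  have hp := weight_mul_abs_nonneg ha x v p
  have hq := weight_mul_abs_nonneg ha x v q
  refine le_trans (hF.2.2.2 _ hv (weight_mul_abs_nonneg ha x v _) (mem_Ici.2 (by positivity)) ?_)
    ((hF.2.2.1 _ hv).2 hp hq hs ht hst)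
  simp only [smul_eq_mul]
  have : |s * p + t * q| ≤ s * |p| + t * |q| := by
    refine (abs_add_le _ _).trans_eq ?_
    rw [abs_mul, abs_mul, abs_of_nonneg hs, abs_of_nonneg ht]
  refine (mul_le_mul_of_nonneg_left this hc).trans_eq ?_
  ring

lemma lagr_lagrangian_nonneg (ha : Weight a) (hF : MemFrakF F) (g : ℝ → ℝ) :
    0 ≤ lagr (lagrangian F a) g :=
  intervalIntegral.integral_nonneg (by norm_num) fun _ _ => lagrangian_nonneg ha hF _

lemma Ifun_eq_ofReal_lagr (ha : Weight a) (hF : MemFrakF F) {K : ℝ≥0} {w g : ℝ → ℝ}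
    (hg : LipschitzWith K g) (hwg : EqOn w g (Ico (-1) 1)) (hw : ∀ x ∈ Ico (-1 : ℝ) 1, 0 ≤ w x) :
    Ifun F a w = ENNReal.ofReal (lagr (lagrangian F a) g) := by
  have hint := intervalIntegrable_comp_of_bounded (continuous_lagrangian ha hF)
    (P := fun x => (x, g x, deriv g x)) (R := 1 + |g 0| + K) (a := -1) (b := 1)
    (measurable_id.prodMk (hg.continuous.measurable.prodMk (measurable_deriv _)))
    (fun x hx => by
      have h1 : |x| ≤ 1 := abs_le.2 hx
      have h2 := hg.abs_le_of_mem hx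
      have h3 := hg.abs_deriv_le x
      have h4 := abs_nonneg (g 0)
      have h5 := K.coe_nonneg
      exact norm_triple_le (by linarith) (by linarith) (by linarith)) (by simp) (by simp)
  rw [lagr, intervalIntegral.integral_of_le (by norm_num), ofReal_integral_eq_lintegral_ofReal
    ((intervalIntegrable_iff_integrableOn_Ioc_of_le (by norm_num)).1 hint)
    (.of_forall fun _ => lagrangian_nonneg ha hF _), Ifun,
    restrict_Ioc_eq_restrict_Icc, ← restrict_Ioo_eq_restrict_Icc]
  refine setLIntegral_congr_fun measurableSet_Ioo fun x hx => ?_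
  have hxI : x ∈ Ico (-1 : ℝ) 1 := ⟨hx.1.le, hx.2⟩
  have hd : deriv w x = deriv g x := by
    refine Filter.EventuallyEq.deriv_eq ?_
    filter_upwards [Ioo_mem_nhds hx.1 hx.2] with y hy
    exact hwg ⟨hy.1.le, hy.2⟩
  have h0 := hw x hxI
  rw [lagrangian, ← hwg hxI, ← hd]
  simp only [max_eq_left h0, min_eq_right hx.2.le, max_eq_right hx.1.le]

end

/-- if the rearrangement inequality holds for all nonnegative piecewise linear
functions, it holds for all nonnegative Lipschitz functions. -/
theorem stmt11 (a F : ℝ → ℝ → ℝ) (ha : Weight a) (hF : MemFrakF F)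
    (H : ∀ u : ℝ → ℝ, PiecewiseLinear u → (∀ x ∈ Icc (-1 : ℝ) 1, 0 ≤ u x) →
      Ifun F a (mrear u) ≤ Ifun F a u) :
    ∀ u : ℝ → ℝ, (∃ K : ℝ≥0, LipschitzOnWith K u (Icc (-1 : ℝ) 1)) →
      (∀ x ∈ Icc (-1 : ℝ) 1, 0 ≤ u x) → Ifun F a (mrear u) ≤ Ifun F a u := by
  rintro u ⟨K, hu⟩ hu0
  obtain ⟨g, hg, hg0, hug⟩ : ∃ g : ℝ → ℝ, LipschitzWith K g ∧ (∀ x, 0 ≤ g x) ∧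
      EqOn u g (Icc (-1) 1) := by
    obtain ⟨g, hg, hug⟩ := hu.extend_real
    refine ⟨fun x => max (g x) 0, hg.max_const 0, fun x => le_max_right _ _, fun x hx => ?_⟩
    simp only
    rw [← hug hx, max_eq_left (hu0 x hx)]
  have hext : ∀ v : ℝ → ℝ, LipschitzWith K v →
      ∃ w, LipschitzWith K w ∧ EqOn (mrear v) w (Ico (-1) 1) := fun v hv =>
    (lipschitzOnWith_mrear hv).extend_real
  have hgk := lipschitzWith_gridInterp hg
  choose G hG hGeq using fun k => hext _ (hgk k)
  obtain ⟨w, hw, hweq⟩ := hext g hg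
  have hnn : ∀ v : ℝ → ℝ, ∀ x ∈ Ico (-1 : ℝ) 1, 0 ≤ mrear v x := fun v x hx =>
    mrear_nonneg v hx.2.le
  have hclose : ∀ k, ∀ x ∈ Icc (-1 : ℝ) 1, |G k x - w x| ≤ 2 * K * (1 / ((k : ℝ) + 1)) := by
    intro k
    have hIco : Ico (-1 : ℝ) 1 ⊆ {x | |G k x - w x| ≤ 2 * K * (1 / ((k : ℝ) + 1))} := by
      intro x hx
      have hε : 0 ≤ 2 * K * (1 / ((k : ℝ) + 1)) := by positivity
      have hb : ∀ v : ℝ → ℝ, LipschitzWith K v → ∀ y ∈ Icc (-1 : ℝ) 1, v y ≤ |v 0| + K :=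
        fun v hv y hy => (le_abs_self _).trans (hv.abs_le_of_mem hy)
      have hab := fun y => abs_le.1 (abs_gridInterp_sub_le hg k y)
      have h1 := mrear_le_add (hb g hg) hε
        (fun y _ => by linarith [(hab y).2] : ∀ y ∈ Icc (-1 : ℝ) 1, gridInterp k g y ≤ _) hx.2
      have h2 := mrear_le_add (hb _ (hgk k)) hε
        (fun y _ => by linarith [(hab y).1] : ∀ y ∈ Icc (-1 : ℝ) 1, g y ≤ _) hx.2
      rw [mem_ofPred_eq, ← hGeq k hx, ← hweq hx, abs_le]
      constructor <;> linarith
    have hcl : IsClosed {x | |G k x - w x| ≤ 2 * K * (1 / ((k : ℝ) + 1))} :=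
      isClosed_le ((hG k).continuous.sub hw.continuous).abs continuous_const
    have := closure_minimal hIco hcl
    rwa [closure_Ico (by norm_num)] at this
  have hlim : ∀ x ∈ Icc (-1 : ℝ) 1, Tendsto (fun k => G k x) atTop (𝓝 (w x)) := fun x hx => by
    rw [tendsto_iff_dist_tendsto_zero]
    refine squeeze_zero (fun _ => dist_nonneg)
      (fun n => (Real.dist_eq _ _).trans_le (hclose n x hx)) ?_
    simpa using (tendsto_one_div_add_atTop_nhds_zero_nat (𝕜 := ℝ)).const_mul (2 * (K : ℝ))
  have hGM : ∀ k, |G k 0| ≤ |w 0| + 2 * K := fun k => by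
    have h1 := hclose k 0 (by simp)
    have h2 := abs_sub_abs_le_abs_sub (G k 0) (w 0)
    have h3 : 2 * K * (1 / ((k : ℝ) + 1)) ≤ 2 * K * 1 := by
      gcongr
      rw [div_le_one (by positivity)]
      linarith [k.cast_nonneg (α := ℝ)]
    linarith
  have hk : ∀ k, lagr (lagrangian F a) (G k) ≤ lagr (lagrangian F a) (gridInterp k g) := by
    intro k
    have hpos := gridInterp_nonneg k hg0
    have := H _ (piecewiseLinear_gridInterp k g) fun x _ => hpos x
    rwa [Ifun_eq_ofReal_lagr ha hF (hG k) (hGeq k) (hnn _),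
      Ifun_eq_ofReal_lagr ha hF (hgk k) (eqOn_refl _ _) fun x _ => hpos x,
      ENNReal.ofReal_le_ofReal_iff (lagr_lagrangian_nonneg ha hF _)] at this
  have hcont := continuous_lagrangian ha hF
  rw [mrear_congr hug, Ifun_eq_ofReal_lagr ha hF hw hweq (hnn _),
    Ifun_eq_ofReal_lagr ha hF hg (hug.mono Ico_subset_Icc_self)
      fun x hx => hu0 x (Ico_subset_Icc_self hx)]
  exact ENNReal.ofReal_le_ofReal (lagr_le_of_tendsto hcont (convexOn_lagrangian ha hF) hG hGM hw
    hlim hk (tendsto_lagr_gridInterp hcont hg))
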